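/- Let k be a field, B = k[x, y]/(x³, y³) (a Noetherian local ring with maximal ideal generated by the classes of x and y), M = B/(x², xy, y²), and M^∨ = Hom_B(M, B). Then for every i ≥ 0 the Betti numbers of M and M^∨ over B are given by: β_i^B(M) = (3i + 2)/2 if i is even and (3i + 3)/2 if i is odd; and β_i^B(M^∨) = (3i + 4)/2 if i is even and (3i + 3)/2 if i is odd. In particular, the quasi-polynomials governing the Betti numbers of M and M^∨ have equal leading terms but different lower-order terms. -/

import Mathlib

open IsLocalRing

/-- `β : ℕ → ℕ` is the sequence of Betti numbers of a *minimal* free resolution of `M`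
over the local ring `B`, i.e. a free resolution with `d(F_{i+1}) ⊆ 𝔪·F_i`. -/
def IsMinimalFreeResolutionBetti (B : Type) [CommRing B] [IsLocalRing B] (M : Type)
    [AddCommGroup M] [Module B M] (β : ℕ → ℕ) : Prop :=
  ∃ (d : ∀ i : ℕ, (Fin (β (i + 1)) → B) →ₗ[B] (Fin (β i) → B))
    (ε : (Fin (β 0) → B) →ₗ[B] M),
      Function.Surjective ε ∧
      LinearMap.ker ε = LinearMap.range (d 0) ∧
      (∀ i, LinearMap.ker (d i) = LinearMap.range (d (i + 1))) ∧
      (∀ i, LinearMap.range (d i) ≤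
        (maximalIdeal B) • (⊤ : Submodule B (Fin (β i) → B)))

/-- The ring `B = k[x,y]/(x³, y³)`. -/
abbrev ringB (k : Type) [Field k] : Type :=
  MvPolynomial (Fin 2) k ⧸
    Ideal.span {(MvPolynomial.X 0 : MvPolynomial (Fin 2) k) ^ 3,
      (MvPolynomial.X 1 : MvPolynomial (Fin 2) k) ^ 3}

/-- The class of `x` in `B`. -/
noncomputable abbrev xB (k : Type) [Field k] : ringB k :=
  Ideal.Quotient.mk _ (MvPolynomial.X 0)

/-- The class of `y` in `B`. -/
noncomputable abbrev yB (k : Type) [Field k] : ringB k :=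
  Ideal.Quotient.mk _ (MvPolynomial.X 1)

/-- The `B`-module `M = B/(x², xy, y²)`. -/
abbrev moduleM (k : Type) [Field k] : Type :=
  ringB k ⧸ Ideal.span {xB k ^ 2, xB k * yB k, yB k ^ 2}

/-- The length of a module as a natural number (with junk value `0` for infinite length). -/
noncomputable def natLength (B N : Type) [CommRing B] [AddCommGroup N] [Module B N] : ℕ :=
  (Module.length B N).toNat

section Length

variable {B : Type} [CommRing B] {N P : Type} [AddCommGroup N] [Module B N]
  [AddCommGroup P] [Module B P]

theorem natLength_eq_add_of_exact [IsArtinian B N] [IsNoetherian B N] {K : Type}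
    [AddCommGroup K] [Module B K] (f : K →ₗ[B] N) (g : N →ₗ[B] P) (hf : Function.Injective f)
    (hg : Function.Surjective g) (hfg : Function.Exact f g) :
    natLength B N = natLength B K + natLength B P := by
  have := isArtinian_of_surjective N g hg
  have := isNoetherian_of_surjective g (LinearMap.range_eq_top.2 hg)
  have := isArtinian_of_injective f hf
  have := isNoetherian_of_injective f hf
  rw [natLength, Module.length_eq_add_of_exact f g hf hg hfg,
    ENat.toNat_add Module.length_ne_top Module.length_ne_top]
  rfl

theorem natLength_eq_ker_add [IsArtinian B N] [IsNoetherian B N] (f : N →ₗ[B] P)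
    (hf : Function.Surjective f) :
    natLength B N = natLength B (LinearMap.ker f) + natLength B P := by
  exact natLength_eq_add_of_exact (LinearMap.ker f).subtype f
    (Submodule.subtype_injective _) hf (LinearMap.exact_subtype_ker_map f)

theorem natLength_eq_ker_add_range [IsArtinian B N] [IsNoetherian B N] (f : N →ₗ[B] P) :
    natLength B N = natLength B (LinearMap.ker f) + natLength B (LinearMap.range f) := by
  rw [natLength_eq_ker_add f.rangeRestrict f.surjective_rangeRestrict,
    LinearMap.ker_rangeRestrict]

theorem natLength_congr (e : N ≃ₗ[B] P) : natLength B N = natLength B P := by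
  rw [natLength, e.length_eq]; rfl

theorem natLength_pi (ι : Type) [Fintype ι] :
    natLength B (ι → N) = Fintype.card ι * natLength B N := by
  rw [natLength, Module.length_pi, ENat.toNat_mul, ENat.card_eq_coe_fintype_card]
  rfl

end Length

/-- The exponents `2, 1, 2, 1, …` in the periodic resolution of `k` over `k[x]/(x³)`. -/
def periodicExp (a : ℕ) : ℕ := if Odd a then 1 else 2

theorem periodicExp_succ (a : ℕ) : periodicExp (a + 1) = 3 - periodicExp a := by
  unfold periodicExp
  rcases Nat.even_or_odd a with h | h
  · simp [h.add_one, Nat.not_odd_iff_even.2 h]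
  · simp [h, Nat.not_odd_iff_even.2 h.add_one]

theorem periodicExp_add_succ (a : ℕ) : periodicExp a + periodicExp (a + 1) = 3 := by
  rw [periodicExp_succ]
  unfold periodicExp
  split_ifs <;> rfl

theorem periodicExp_le (a : ℕ) : periodicExp a ≤ 3 := by
  have := periodicExp_add_succ a
  omega

/-- The differential in degree `i + 1` of `P ⊗ N`, where `P` is the tensor product of the
periodic complexes with differentials `x, x², x, …` and `y, y², y, …`. The component with index
`a` in degree `i` is the one of bidegree `(a, i - a)`. -/
def periodicDiff {B : Type} [CommRing B] (x y : B) (N : Type) [AddCommGroup N] [Module B N]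
    (i : ℕ) : (Fin (i + 2) → N) →ₗ[B] (Fin (i + 1) → N) :=
  LinearMap.pi fun a => x ^ periodicExp (a + 1) • LinearMap.proj a.succ +
    ((-1) ^ (a : ℕ) * y ^ periodicExp (i + 1 - a)) • LinearMap.proj a.castSucc

theorem periodicDiff_apply {B : Type} [CommRing B] (x y : B) {N : Type} [AddCommGroup N]
    [Module B N] (i : ℕ) (c : Fin (i + 2) → N) (a : Fin (i + 1)) :
    periodicDiff x y N i c a = x ^ periodicExp (a + 1) • c a.succ +
      ((-1) ^ (a : ℕ) * y ^ periodicExp (i + 1 - a)) • c a.castSucc := rfl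

/-- The length of the image of the differential of `P ⊗ N` that starts in degree `i`. -/
noncomputable def periodicRank {B : Type} [CommRing B] (x y : B) (N : Type) [AddCommGroup N]
    [Module B N] : ℕ → ℕ
  | 0 => 0
  | i + 1 => natLength B (LinearMap.range (periodicDiff x y N i))

/-- The properties of `x, y ∈ k[x,y]/(x³,y³)` that determine the Betti numbers. -/
structure IsCubicPair {B : Type} [CommRing B] (x y : B) : Prop where
  x_cube : x ^ 3 = 0
  y_cube : y ^ 3 = 0
  isMaximal : (Ideal.span {x, y}).IsMaximal
  of_x_pow_mul : ∀ {i j : ℕ} {c a : B}, i ≤ 3 → j ≤ 3 → x ^ j * c = y ^ i * a →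
    ∃ p q, c = x ^ (3 - j) * p + y ^ i * q
  of_y_pow_mul : ∀ {i j : ℕ} {c a : B}, i ≤ 3 → j ≤ 3 → y ^ j * c = x ^ i * a →
    ∃ p q, c = y ^ (3 - j) * p + x ^ i * q

section Complex

variable {B : Type} [CommRing B] {x y : B}

theorem IsCubicPair.exists_boundary_nat (h : IsCubicPair x y) (i : ℕ) (c : ℕ → B)
    (hc : ∀ a ≤ i, x ^ periodicExp (a + 1) * c (a + 1) +
      ((-1) ^ a * y ^ periodicExp (i + 1 - a)) * c a = 0) (n : ℕ) (hn : n ≤ i + 1) :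
    ∃ d : ℕ → B, ∀ a ≤ n, x ^ periodicExp (a + 1) * d (a + 1) +
      ((-1) ^ a * y ^ periodicExp (i + 2 - a)) * d a = c a := by
  induction n with
  | zero =>
    have h0 := hc 0 (Nat.zero_le _)
    obtain ⟨p, q, hpq⟩ := h.of_y_pow_mul (c := c 0) (a := - c 1) (i := periodicExp 1)
      (j := periodicExp (i + 1)) (periodicExp_le _) (periodicExp_le _) (by
        simp at h0; linear_combination h0)
    refine ⟨fun a => if a = 0 then p else q, fun a ha => ?_⟩
    obtain rfl : a = 0 := by omega
    rw [hpq, ← periodicExp_succ]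
    simp
    ring
  | succ n ih =>
    obtain ⟨d, hd⟩ := ih (by omega)
    have h1 := hc n (by omega)
    have h2 := hd n le_rfl
    have h3 : y ^ periodicExp (i + 1 - n) * y ^ periodicExp (i + 2 - n) = 0 := by
      rw [← pow_add, show i + 2 - n = i + 1 - n + 1 by omega, periodicExp_add_succ, h.y_cube]
    obtain ⟨p, q, hpq⟩ := h.of_x_pow_mul
      (c := c (n + 1) - (-1) ^ (n + 1) * y ^ periodicExp (i + 1 - n) * d (n + 1)) (a := 0) (i := 3)
      (j := periodicExp (n + 1)) le_rfl (periodicExp_le _) (by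
        linear_combination h1 + (-1) ^ n * y ^ periodicExp (i + 1 - n) * h2
          - (-1) ^ n * (-1) ^ n * d n * h3)
    rw [← periodicExp_succ, h.y_cube] at hpq
    refine ⟨Function.update d (n + 2) p, fun a ha => ?_⟩
    rcases Nat.lt_or_ge n a with hna | hna
    · obtain rfl : a = n + 1 := by omega
      rw [Function.update_self, Function.update_of_ne (by omega),
        show i + 2 - (n + 1) = i + 1 - n by omega]
      linear_combination - hpq
    · rw [Function.update_of_ne (by omega), Function.update_of_ne (by omega)]
      exact hd a hna

theorem IsCubicPair.exists_boundary (h : IsCubicPair x y) (i : ℕ) (c : Fin (i + 2) → B)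
    (hc : periodicDiff x y B i c = 0) : ∃ d, periodicDiff x y B (i + 1) d = c := by
  obtain ⟨d, hd⟩ := h.exists_boundary_nat i (fun a => if ha : a < i + 2 then c ⟨a, ha⟩ else 0)
    (fun a ha => by
      have := congrFun hc ⟨a, by omega⟩
      rw [dif_pos (by omega), dif_pos (by omega)]
      simpa [periodicDiff_apply] using this) (i + 1) le_rfl
  refine ⟨fun a => d a, funext fun a => ?_⟩
  have := hd a (by omega)
  rw [dif_pos a.2] at this
  simpa [periodicDiff_apply] using this

theorem IsCubicPair.periodicDiff_comp (h : IsCubicPair x y)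
    {N : Type} [AddCommGroup N] [Module B N] (i : ℕ)
    (c : Fin (i + 3) → N) : periodicDiff x y N i (periodicDiff x y N (i + 1) c) = 0 := by
  funext a
  have hx : x ^ periodicExp (a + 1) * x ^ periodicExp (a + 1 + 1) = 0 := by
    rw [← pow_add, periodicExp_add_succ, h.x_cube]
  have hy : y ^ periodicExp (i + 1 - a) * y ^ periodicExp (i + 1 + 1 - a) = 0 := by
    rw [← pow_add, show i + 1 + 1 - (a : ℕ) = i + 1 - a + 1 by omega, periodicExp_add_succ,
      h.y_cube]
  simp only [periodicDiff_apply, smul_add, smul_smul, Fin.val_succ, Fin.val_castSucc,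
    Pi.zero_apply, Fin.succ_castSucc]
  rw [← mul_assoc, hx, show i + 1 + 1 - ((a : ℕ) + 1) = i + 1 - a by omega,
    show (-1) ^ (a : ℕ) * y ^ periodicExp (i + 1 - a) *
      ((-1) ^ (a : ℕ) * y ^ periodicExp (i + 1 + 1 - a)) = 0 by
        linear_combination (-1) ^ (a : ℕ) * (-1) ^ (a : ℕ) * hy]
  module

theorem IsCubicPair.ker_periodicDiff_free (h : IsCubicPair x y) (n i : ℕ) :
    LinearMap.ker (periodicDiff x y (Fin n → B) i) =
      LinearMap.range (periodicDiff x y (Fin n → B) (i + 1)) := by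
  ext c
  constructor
  · intro hc
    have hc' : ∀ t, periodicDiff x y B i (fun a => c a t) = 0 := fun t =>
      funext fun a => congrFun (congrFun hc a) t
    choose d hd using fun t => h.exists_boundary i _ (hc' t)
    exact ⟨fun a t => d t a, funext fun a => funext fun t => congrFun (hd t) a⟩
  · rintro ⟨d, rfl⟩
    exact h.periodicDiff_comp i d

theorem range_periodicDiff_free (n : ℕ) (c : Fin n → B) :
    (fun _ => c) ∈ LinearMap.range (periodicDiff x y (Fin n → B) 0) ↔
      ∀ t, c t ∈ Ideal.span {x, y} := by
  simp only [Ideal.mem_span_pair]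
  constructor
  · rintro ⟨d, hd⟩ t
    have := congrFun (congrFun hd 0) t
    refine ⟨d 1 t, d 0 t, ?_⟩
    simpa [periodicDiff_apply, periodicExp, mul_comm] using this
  · intro hc
    choose p q hpq using hc
    refine ⟨![q, p], funext fun a => funext fun t => ?_⟩
    obtain rfl : a = 0 := Fin.fin_one_eq_zero a
    rw [← hpq]
    simp [periodicDiff_apply, periodicExp, mul_comm]

theorem IsCubicPair.natLength_residue (h : IsCubicPair x y) :
    natLength B (B ⧸ Ideal.span {x, y}) = 1 := by
  have := isSimpleModule_iff_isCoatom.2 h.isMaximal.1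
  rw [natLength, Module.length_eq_one]
  rfl

theorem periodicDiff_compLeft {N P : Type} [AddCommGroup N] [Module B N] [AddCommGroup P]
    [Module B P] (f : N →ₗ[B] P) (i : ℕ) (c : Fin (i + 2) → N) :
    periodicDiff x y P i (f.compLeft _ c) = f.compLeft _ (periodicDiff x y N i c) := by
  funext a
  simp [periodicDiff_apply]

variable [IsArtinianRing B] {N : Type} [AddCommGroup N] [Module B N] {n : ℕ}
  {ε : (Fin n → B) →ₗ[B] N}

theorem periodicRank_eq_natLength_add (hε : Function.Surjective ε) {i : ℕ}
    (Z : Submodule B (Fin (i + 1) → LinearMap.ker ε))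
    (hZ : ∀ c, c ∈ Z ↔ (LinearMap.ker ε).subtype.compLeft _ c ∈
      LinearMap.range (periodicDiff x y (Fin n → B) i)) :
    periodicRank x y (Fin n → B) (i + 1) = natLength B Z + periodicRank x y N (i + 1) := by
  refine natLength_eq_add_of_exact
    ((((LinearMap.ker ε).subtype.compLeft _).domRestrict Z).codRestrict
      (LinearMap.range (periodicDiff x y (Fin n → B) i)) fun c => (hZ c).1 c.2)
    ((ε.compLeft _).restrict (q := LinearMap.range (periodicDiff x y N i)) ?_) ?_ ?_ ?_
  · rintro _ ⟨c, rfl⟩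
    exact ⟨ε.compLeft _ c, periodicDiff_compLeft ε i c⟩
  · intro c c' hcc
    refine Subtype.ext (funext fun a => Subtype.ext ?_)
    exact congrFun (congrArg Subtype.val hcc) a
  · rintro ⟨_, c, rfl⟩
    choose d hd using fun a => hε (c a)
    refine ⟨⟨_, d, rfl⟩, Subtype.ext ?_⟩
    refine (periodicDiff_compLeft ε i d).symm.trans ?_
    congr 1
    exact funext hd
  · rintro ⟨c, hc⟩
    constructor
    · intro hc0
      have hc1 : ∀ a, c a ∈ LinearMap.ker ε := fun a => congrFun (congrArg Subtype.val hc0) a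
      exact ⟨⟨fun a => ⟨c a, hc1 a⟩, (hZ _).2 hc⟩, rfl⟩
    · rintro ⟨d, hd⟩
      refine Subtype.ext (funext fun a => ?_)
      have : c a = d.1 a := congrFun (congrArg Subtype.val hd.symm) a
      change ε (c a) = 0
      rw [this]
      exact (d.1 a).2

theorem IsCubicPair.periodicRank_shift (h : IsCubicPair x y) (hε : Function.Surjective ε)
    (hmin : ∀ c ∈ LinearMap.ker ε, ∀ t, c t ∈ Ideal.span {x, y}) (i : ℕ) :
    periodicRank x y (Fin n → B) (i + 1) + periodicRank x y (LinearMap.ker ε) i =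
      periodicRank x y N (i + 1) + (i + 1) * natLength B (LinearMap.ker ε) := by
  have hpi := natLength_pi (B := B) (N := LinearMap.ker ε) (Fin (i + 1))
  rw [Fintype.card_fin] at hpi
  cases i with
  | zero =>
    rw [periodicRank_eq_natLength_add hε ⊤, ← hpi, natLength_congr Submodule.topEquiv]
    · simp only [periodicRank]; omega
    · intro c
      simp only [Submodule.mem_top, true_iff]
      convert (range_periodicDiff_free n (c 0)).2 (hmin _ (c 0).2) using 1
      funext a
      obtain rfl : a = 0 := Fin.fin_one_eq_zero a
      rfl
  | succ i =>
    rw [periodicRank_eq_natLength_add hε (LinearMap.ker (periodicDiff x y (LinearMap.ker ε) i)), ← hpi,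
      natLength_eq_ker_add_range (periodicDiff x y (LinearMap.ker ε) i)]
    · exact (add_right_comm _ _ _).trans (add_comm _ _)
    · intro c
      rw [← h.ker_periodicDiff_free, LinearMap.mem_ker, LinearMap.mem_ker, periodicDiff_compLeft]
      constructor
      · intro hc; rw [hc, map_zero]
      · intro hc
        exact funext fun a => Subtype.ext (congrFun hc a)

theorem IsCubicPair.natLength_eq_add_rank (h : IsCubicPair x y) (hε : Function.Surjective ε)
    (hmin : ∀ c ∈ LinearMap.ker ε, ∀ t, c t ∈ Ideal.span {x, y}) :
    natLength B N = n + periodicRank x y N 1 := by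
  have h1 := h.periodicRank_shift hε hmin 0
  have h2 := natLength_eq_ker_add ε hε
  have h3 := natLength_eq_ker_add ((Ideal.span {x, y}).mkQ.compLeft (Fin n))
    (fun c => ⟨fun a => (c a).out, funext fun a => Quotient.out_eq _⟩)
  rw [natLength_pi (N := B ⧸ Ideal.span {x, y}), h.natLength_residue, Fintype.card_fin,
    mul_one] at h3
  have h4 : natLength B (LinearMap.ker ((Ideal.span {x, y}).mkQ.compLeft (Fin n))) =
      periodicRank x y (Fin n → B) 1 := by
    refine natLength_congr (LinearEquiv.ofSubmodules
      (LinearEquiv.funUnique (Fin 1) B (Fin n → B)).symm _ _ ?_)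
    ext c
    obtain ⟨c, rfl⟩ := (LinearEquiv.funUnique (Fin 1) B (Fin n → B)).symm.surjective c
    rw [Submodule.mem_map_equiv, LinearEquiv.symm_symm, LinearEquiv.apply_symm_apply]
    refine Iff.trans ?_ (range_periodicDiff_free n c).symm
    rw [LinearMap.mem_ker, funext_iff]
    exact forall_congr' fun t => Submodule.Quotient.mk_eq_zero _
  simp only [periodicRank] at h1 h4 ⊢
  omega

theorem IsCubicPair.homology_shift (h : IsCubicPair x y) (hε : Function.Surjective ε)
    (hmin : ∀ c ∈ LinearMap.ker ε, ∀ t, c t ∈ Ideal.span {x, y}) (i : ℕ) :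
    ((i + 2) * natLength B N : ℤ) - periodicRank x y N (i + 1) - periodicRank x y N (i + 2) =
      (i + 1) * natLength B (LinearMap.ker ε) - periodicRank x y (LinearMap.ker ε) i
        - periodicRank x y (LinearMap.ker ε) (i + 1) := by
  have h1 := h.periodicRank_shift hε hmin i
  have h2 := h.periodicRank_shift hε hmin (i + 1)
  have h3 := natLength_eq_ker_add ε hε
  have h4 := natLength_eq_ker_add_range (periodicDiff x y (Fin n → B) i)
  rw [h.ker_periodicDiff_free, natLength_pi, Fintype.card_fin] at h4
  change _ = periodicRank x y (Fin n → B) (i + 2) + periodicRank x y (Fin n → B) (i + 1) at h4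
  zify at h1 h2 h3 h4
  rw [h3] at h4
  linarith

end Complex

/-- The Betti numbers of `N` are the lengths of the homology modules of `P ⊗ N`. -/
theorem IsCubicPair.betti_eq {B : Type} [CommRing B] [IsArtinianRing B] [IsLocalRing B] {x y : B}
    (h : IsCubicPair x y) (i : ℕ) : ∀ (N : Type) [AddCommGroup N] [Module B N] (β : ℕ → ℕ),
    IsMinimalFreeResolutionBetti B N β →
    (β i : ℤ) = (i + 1) * natLength B N - periodicRank x y N i - periodicRank x y N (i + 1) := by
  have hm : maximalIdeal B = Ideal.span {x, y} := (eq_maximalIdeal h.isMaximal).symm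
  have hmem : ∀ (n : ℕ) (c : Fin n → B), c ∈ maximalIdeal B • (⊤ : Submodule B (Fin n → B)) →
      ∀ t, c t ∈ Ideal.span {x, y} := by
    intro n c hc t
    rw [hm] at hc
    refine Submodule.smul_induction_on hc (fun r hr d _ => ?_) fun c d => Ideal.add_mem _
    exact Ideal.mul_mem_right _ _ hr
  induction i with
  | zero =>
    rintro N _ _ β ⟨d, ε, hε, h0, -, hmin⟩
    rw [h.natLength_eq_add_rank hε fun c hc => hmem _ c (hmin 0 (h0 ▸ hc))]
    simp [periodicRank]
  | succ i ih =>
    rintro N _ _ β ⟨d, ε, hε, h0, hd, hmin⟩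
    have := h.homology_shift hε (fun c hc => hmem _ c (hmin 0 (h0 ▸ hc))) i
    rw [ih (LinearMap.ker ε) (fun i => β (i + 1)) ⟨fun i => d (i + 1),
      (d 0).codRestrict (LinearMap.ker ε) fun c => h0 ▸ LinearMap.mem_range_self _ c, ?_, ?_,
      fun i => hd (i + 1), fun i => hmin (i + 1)⟩, ← this]
    · push_cast; ring
    · rintro ⟨c, hc⟩
      rw [h0] at hc
      obtain ⟨b, rfl⟩ := hc
      exact ⟨b, rfl⟩
    · rw [LinearMap.ker_codRestrict, hd 0]

section Rank

variable {B : Type} [CommRing B] {x y : B}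
  {N : Type} [AddCommGroup N] [Module B N]

theorem IsCubicPair.periodicRank_of_residue_surjection (h : IsCubicPair x y)
    [IsArtinian B N] [IsNoetherian B N]
    (π : N →ₗ[B] B ⧸ Ideal.span {x, y}) (hπ : Function.Surjective π)
    (hxy : ∀ n m, x • n + y • m = 0 → π n = 0 ∧ π m = 0)
    (hker : ∀ n, π n = 0 → x • n = 0 ∧ y • n = 0)
    (hsq : ∀ n : N, x ^ 2 • n = 0 ∧ y ^ 2 • n = 0) (i : ℕ) :
    periodicRank x y N (i + 1) =
      Fintype.card {a : Fin (i + 2) // Odd (a : ℕ) ∨ Odd (i + 1 - a : ℕ)} := by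
  let g : (Fin (i + 2) → N) →ₗ[B]
      ({a : Fin (i + 2) // Odd (a : ℕ) ∨ Odd (i + 1 - a : ℕ)} → B ⧸ Ideal.span {x, y}) :=
    LinearMap.pi fun a => π ∘ₗ LinearMap.proj a.1
  have hg : Function.Surjective g := by
    intro t
    choose s hs using hπ
    refine ⟨fun a => if ha : _ then s (t ⟨a, ha⟩) else 0, funext fun a => ?_⟩
    simp only [g, LinearMap.pi_apply, LinearMap.comp_apply, LinearMap.proj_apply, dif_pos a.2, hs]
  have hx : ∀ (a : ℕ) (n : N), (Odd a → π n = 0) → x ^ periodicExp a • n = 0 := by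
    intro a n hn
    unfold periodicExp
    split_ifs with ha
    · simpa using (hker n (hn ha)).1
    · exact (hsq n).1
  have hy : ∀ (a : ℕ) (n : N), (Odd a → π n = 0) → y ^ periodicExp a • n = 0 := by
    intro a n hn
    unfold periodicExp
    split_ifs with ha
    · simpa using (hker n (hn ha)).2
    · exact (hsq n).2
  have hkg : LinearMap.ker (periodicDiff x y N i) = LinearMap.ker g := by
    ext c
    rw [LinearMap.mem_ker, LinearMap.mem_ker]
    constructor
    · refine fun hc => funext fun ⟨a, ha⟩ => ?_
      change π (c a) = 0
      have hpos : ∀ e : ℕ, 0 < periodicExp e := fun e => by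
        unfold periodicExp; split_ifs <;> simp
      rcases ha with ha | ha
      · obtain ⟨b, rfl⟩ : ∃ b : Fin (i + 1), a = b.succ :=
          ⟨a.pred (by rintro rfl; simp at ha), by simp⟩
        have hb := congrFun hc b
        rw [Fin.val_succ] at ha
        rw [periodicDiff_apply, show periodicExp (b + 1) = 1 from if_pos ha, pow_one,
          ← Nat.sub_add_cancel (hpos (i + 1 - b)), pow_succ', mul_left_comm, mul_smul] at hb
        exact (hxy _ _ hb).1
      · obtain ⟨b, rfl⟩ : ∃ b : Fin (i + 1), a = b.castSucc :=
          ⟨a.castPred (by rintro rfl; simp at ha), by simp⟩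
        have hb := congrFun hc b
        rw [Fin.val_castSucc] at ha
        rw [periodicDiff_apply, show periodicExp (i + 1 - b) = 1 from if_pos ha, pow_one,
          ← Nat.sub_add_cancel (hpos (b + 1)), pow_succ', mul_smul, mul_comm _ y, mul_smul] at hb
        have := (hxy _ _ hb).2
        rcases neg_one_pow_eq_or B (b : ℕ) with hs | hs <;> simpa [hs] using this
    · refine fun hc => funext fun a => ?_
      rw [periodicDiff_apply, hx _ _ fun ha => congrFun hc ⟨a.succ, Or.inl (by simpa using ha)⟩,
        mul_smul, hy _ _ fun ha => congrFun hc ⟨a.castSucc, Or.inr (by simpa using ha)⟩]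
      simp
  have h1 := natLength_eq_ker_add_range (periodicDiff x y N i)
  have h2 := natLength_eq_ker_add g hg
  rw [natLength_pi (N := B ⧸ Ideal.span {x, y}), h.natLength_residue, mul_one, ← hkg] at h2
  exact Nat.add_left_cancel (h1.symm.trans h2)

theorem IsCubicPair.periodicRank_of_residue_injection (h : IsCubicPair x y)
    (ι : (B ⧸ Ideal.span {x, y}) →ₗ[B] N) (hι : Function.Injective ι)
    (hxy : ∀ n : N, x • n ∈ LinearMap.range ι ∧ y • n ∈ LinearMap.range ι)
    (hx : ∀ t, ∃ n, x • n = ι t ∧ y • n = 0) (hy : ∀ t, ∃ n, x • n = 0 ∧ y • n = ι t)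
    (hsq : ∀ n : N, x ^ 2 • n = 0 ∧ y ^ 2 • n = 0) (i : ℕ) :
    periodicRank x y N (i + 1) =
      Fintype.card {a : Fin (i + 1) // Even (a : ℕ) ∨ Even (i - a : ℕ)} := by
  let g : ({a : Fin (i + 1) // Even (a : ℕ) ∨ Even (i - a : ℕ)} → B ⧸ Ideal.span {x, y})
      →ₗ[B] (Fin (i + 1) → N) :=
    LinearMap.pi fun a => if ha : Even (a : ℕ) ∨ Even (i - a : ℕ) then
      ι ∘ₗ LinearMap.proj (⟨a, ha⟩ : {a : Fin (i + 1) // Even (a : ℕ) ∨ Even (i - a : ℕ)}) else 0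
  have hg_pos : ∀ t a ha, g t a = ι (t ⟨a, ha⟩) := by
    intro t a ha
    simp only [g, LinearMap.pi_apply, dif_pos ha, LinearMap.comp_apply, LinearMap.proj_apply]
  have hg_neg : ∀ t (a : Fin (i + 1)), ¬ (Even (a : ℕ) ∨ Even (i - a : ℕ)) → g t a = 0 := by
    intro t a ha
    simp only [g, LinearMap.pi_apply, dif_neg ha, LinearMap.zero_apply]
  have hg : Function.Injective g := by
    refine fun s t hst => funext fun ⟨a, ha⟩ => hι ?_
    rw [← hg_pos s a ha, ← hg_pos t a ha, hst]
  have hsq' : ∀ (a : ℕ) (n : N), ¬ Odd a → x ^ periodicExp a • n = 0 ∧ y ^ periodicExp a • n = 0 :=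
    fun a n ha => by rw [periodicExp, if_neg ha]; exact hsq n
  have hrange : ∀ (a : ℕ) (n : N), x ^ periodicExp a • n ∈ LinearMap.range ι ∧
      y ^ periodicExp a • n ∈ LinearMap.range ι := by
    intro a n
    by_cases ha : Odd a
    · rw [periodicExp, if_pos ha, pow_one, pow_one]
      exact hxy n
    · rw [(hsq' a n ha).1, (hsq' a n ha).2]
      exact ⟨zero_mem _, zero_mem _⟩
  have hx0 : ∀ (a : ℕ) (n : N), x • n = 0 → x ^ periodicExp a • n = 0 := by
    intro a n hn
    unfold periodicExp
    split_ifs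
    · rwa [pow_one]
    · exact (hsq n).1
  have hy0 : ∀ (a : ℕ) (n : N), y • n = 0 → y ^ periodicExp a • n = 0 := by
    intro a n hn
    unfold periodicExp
    split_ifs
    · rwa [pow_one]
    · exact (hsq n).2
  have hrg : LinearMap.range (periodicDiff x y N i) = LinearMap.range g := by
    ext c
    constructor
    · rintro ⟨d, rfl⟩
      have hd : ∀ a, ∃ t, ι t = periodicDiff x y N i d a := fun a => by
        rw [periodicDiff_apply, mul_smul]
        exact add_mem (hrange _ _).1 (Submodule.smul_mem _ _ (hrange _ _).2)
      choose t ht using hd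
      refine ⟨fun a => t a, funext fun a => ?_⟩
      by_cases ha : Even (a : ℕ) ∨ Even (i - a : ℕ)
      · rw [hg_pos _ _ ha, ht]
      · rw [hg_neg _ _ ha, periodicDiff_apply, mul_smul, (hsq' _ _ _).1, (hsq' _ _ _).2]
        · simp
        · rw [show i + 1 - (a : ℕ) = i - a + 1 by omega]
          grind
        · grind
    · rintro ⟨t, rfl⟩
      choose u hux huy using hx
      choose v hvx hvy using hy
      let tx : Fin (i + 1) → B ⧸ Ideal.span {x, y} := fun a =>
        if ha : Even (a : ℕ) then t ⟨a, Or.inl ha⟩ else 0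
      let ty : Fin (i + 1) → B ⧸ Ideal.span {x, y} := fun a =>
        if ha : ¬ Even (a : ℕ) ∧ Even (i - a : ℕ) then t ⟨a, Or.inr ha.2⟩ else 0
      have hu : ∀ a : Fin (i + 1), x ^ periodicExp (a + 1) • u (tx a) = ι (tx a) := by
        intro a
        by_cases ha : Even (a : ℕ)
        · rw [show periodicExp (a + 1) = 1 from if_pos ha.add_one, pow_one, hux]
        · rw [(hsq' _ _ (by grind)).1, show tx a = 0 from dif_neg ha, map_zero]
      have hv : ∀ a : Fin (i + 1), y ^ periodicExp (i + 1 - a) • v (ty a) = ι (ty a) := by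
        intro a
        rw [show i + 1 - (a : ℕ) = i - a + 1 by omega]
        by_cases ha : Even (i - a : ℕ)
        · rw [show periodicExp (i - a + 1) = 1 from if_pos ha.add_one, pow_one, hvy]
        · rw [(hsq' _ _ (by grind)).2, show ty a = 0 from dif_neg fun h => ha h.2, map_zero]
      refine ⟨fun a => Fin.cases 0 (fun b => u (tx b)) a +
        Fin.lastCases 0 (fun b => (-1 : B) ^ (b : ℕ) • v (ty b)) a, funext fun a => ?_⟩
      have hlast : x ^ periodicExp (a + 1) • (Fin.lastCases 0
          (fun b : Fin (i + 1) => (-1 : B) ^ (b : ℕ) • v (ty b)) a.succ : N) = 0 := by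
        refine hx0 _ _ ?_
        induction a.succ using Fin.lastCases with
        | last => simp
        | cast b => simp [smul_comm x, hvx]
      have hfirst : y ^ periodicExp (i + 1 - a) •
          (Fin.cases 0 (fun b : Fin (i + 1) => u (tx b)) a.castSucc : N) = 0 := by
        refine hy0 _ _ ?_
        induction a.castSucc using Fin.cases with
        | zero => simp
        | succ b => simp [huy]
      rw [periodicDiff_apply, smul_add, hlast, mul_smul, smul_add, hfirst, Fin.cases_succ,
        Fin.lastCases_castSucc, hu, zero_add, add_zero, smul_comm (y ^ _), hv, smul_smul,
        ← pow_add, Even.neg_one_pow ⟨_, rfl⟩, one_smul]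
      by_cases ha : Even (a : ℕ)
      · rw [hg_pos _ _ (Or.inl ha), show tx a = _ from dif_pos ha,
          show ty a = 0 from dif_neg fun h => h.1 ha, map_zero, add_zero]
      · rw [show tx a = 0 from dif_neg ha, map_zero, zero_add]
        by_cases ha' : Even (i - a : ℕ)
        · rw [hg_pos _ _ (Or.inr ha'), show ty a = _ from dif_pos ⟨ha, ha'⟩]
        · rw [hg_neg _ _ (by tauto), show ty a = 0 from dif_neg fun h => ha' h.2, map_zero]
  rw [periodicRank, hrg, ← natLength_congr (LinearEquiv.ofInjective g hg),
    natLength_pi (N := B ⧸ Ideal.span {x, y}), h.natLength_residue, mul_one]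

end Rank

theorem card_fin_subtype_eq (n : ℕ) (p : ℕ → Prop) [DecidablePred p] :
    Fintype.card {a : Fin n // p a} = Nat.count p n := by
  rw [Nat.count_eq_card_filter_range, Fintype.card_subtype, Finset.card_filter, Finset.card_filter,
    Fin.sum_univ_eq_sum_range (fun a => if p a then 1 else 0)]

theorem count_even (n : ℕ) : Nat.count Even n = (n + 1) / 2 := by
  induction n with
  | zero => simp
  | succ n ih => rw [Nat.count_succ, ih]; split_ifs with h <;> grind

theorem count_odd (n : ℕ) : Nat.count Odd n = n / 2 := by
  induction n with
  | zero => simp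
  | succ n ih => rw [Nat.count_succ, ih]; split_ifs with h <;> grind

theorem card_odd_or_odd (i : ℕ) :
    Fintype.card {a : Fin (i + 1) // Odd (a : ℕ) ∨ Odd (i - a : ℕ)} =
      if Even i then i / 2 else i + 1 := by
  split_ifs with hi
  · rw [Fintype.card_congr (Equiv.subtypeEquivRight (q := fun a : Fin (i + 1) => Odd (a : ℕ))
      fun a => ?_), card_fin_subtype_eq, count_odd]
    · grind
    · have := a.2
      grind
  · rw [Fintype.card_congr (Equiv.subtypeUnivEquiv fun a => ?_), Fintype.card_fin]
    have := a.2
    grind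

theorem card_even_or_even (i : ℕ) :
    Fintype.card {a : Fin (i + 1) // Even (a : ℕ) ∨ Even (i - a : ℕ)} =
      if Even i then i / 2 + 1 else i + 1 := by
  split_ifs with hi
  · rw [Fintype.card_congr (Equiv.subtypeEquivRight (q := fun a : Fin (i + 1) => Even (a : ℕ))
      fun a => ?_), card_fin_subtype_eq, count_even]
    · omega
    · have := a.2
      grind
  · rw [Fintype.card_congr (Equiv.subtypeUnivEquiv fun a => ?_), Fintype.card_fin]
    have := a.2
    grind

section Modules

variable {B : Type} [CommRing B] {x y : B}

theorem IsCubicPair.mem_of_mul_socle_eq_zero (h : IsCubicPair x y)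
    {c : B} (hc : x ^ 2 * (y ^ 2 * c) = 0) :
    c ∈ Ideal.span {x, y} := by
  obtain ⟨p, q, hpq⟩ := h.of_x_pow_mul (i := 3) (j := 2) (a := 0) le_rfl (by simp)
    (hc.trans (mul_zero _).symm)
  rw [h.y_cube, zero_mul, add_zero] at hpq
  obtain ⟨r, s, rfl⟩ := h.of_y_pow_mul (i := 1) (j := 2) (by simp) (by simp) hpq
  exact Ideal.mem_span_pair.2 ⟨s, r, by ring⟩

theorem IsCubicPair.mem_of_linear_mem_sq (h : IsCubicPair x y) {c d : B}
    (hcd : x * c + y * d ∈ Ideal.span {x ^ 2, x * y, y ^ 2}) :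
    c ∈ Ideal.span {x, y} ∧ d ∈ Ideal.span {x, y} := by
  obtain ⟨p, q, hpq⟩ := Submodule.mem_span_insert.1 hcd
  obtain ⟨hq, hpq⟩ := hpq
  obtain ⟨r, s, rfl⟩ := Ideal.mem_span_pair.1 hq
  rw [smul_eq_mul] at hpq
  refine ⟨h.mem_of_mul_socle_eq_zero ?_, h.mem_of_mul_socle_eq_zero ?_⟩
  · linear_combination x * y ^ 2 * hpq + (p * y ^ 2) * h.x_cube +
      (s * x * y + r * x ^ 2 - x * d) * h.y_cube
  · linear_combination x ^ 2 * y * hpq + (p * x * y + r * y ^ 2 - y * c) * h.x_cube +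
      (s * x ^ 2) * h.y_cube

theorem span_sq_le_span : Ideal.span {x ^ 2, x * y, y ^ 2} ≤ Ideal.span {x, y} := by
  rw [Ideal.span_le]
  rintro _ (rfl | rfl | rfl)
  · exact Ideal.mem_span_pair.2 ⟨x, 0, by ring⟩
  · exact Ideal.mem_span_pair.2 ⟨y, 0, by ring⟩
  · exact Ideal.mem_span_pair.2 ⟨0, y, by ring⟩

theorem IsCubicPair.periodicRank_quotient [IsArtinianRing B] (h : IsCubicPair x y) (i : ℕ) :
    periodicRank x y (B ⧸ Ideal.span {x ^ 2, x * y, y ^ 2}) (i + 1) =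
      if Even (i + 1) then (i + 1) / 2 else i + 2 := by
  have hx2 : x ^ 2 ∈ Ideal.span {x ^ 2, x * y, y ^ 2} := Ideal.subset_span (by simp)
  have hxy : x * y ∈ Ideal.span {x ^ 2, x * y, y ^ 2} := Ideal.subset_span (by simp)
  have hy2 : y ^ 2 ∈ Ideal.span {x ^ 2, x * y, y ^ 2} := Ideal.subset_span (by simp)
  rw [h.periodicRank_of_residue_surjection (Submodule.factor span_sq_le_span)
    (Submodule.factor_surjective span_sq_le_span),
    card_odd_or_odd]
  · intro n m hnm
    obtain ⟨c, rfl⟩ := Submodule.Quotient.mk_surjective _ n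
    obtain ⟨d, rfl⟩ := Submodule.Quotient.mk_surjective _ m
    obtain ⟨hc, hd⟩ := h.mem_of_linear_mem_sq ((Submodule.Quotient.mk_eq_zero _).1 hnm)
    exact ⟨(Submodule.Quotient.mk_eq_zero _).2 hc, (Submodule.Quotient.mk_eq_zero _).2 hd⟩
  · intro n hn
    obtain ⟨c, rfl⟩ := Submodule.Quotient.mk_surjective _ n
    obtain ⟨p, q, rfl⟩ := Ideal.mem_span_pair.1 ((Submodule.Quotient.mk_eq_zero _).1 hn)
    constructor
    · refine (Submodule.Quotient.mk_eq_zero _).2 ?_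
      convert add_mem (Ideal.mul_mem_left _ p hx2) (Ideal.mul_mem_left _ q hxy) using 1
      change _ * _ = _
      ring
    · refine (Submodule.Quotient.mk_eq_zero _).2 ?_
      convert add_mem (Ideal.mul_mem_left _ p hxy) (Ideal.mul_mem_left _ q hy2) using 1
      change _ * _ = _
      ring
  · intro n
    obtain ⟨c, rfl⟩ := Submodule.Quotient.mk_surjective _ n
    exact ⟨(Submodule.Quotient.mk_eq_zero _).2 (Ideal.mul_mem_right _ _ hx2),
      (Submodule.Quotient.mk_eq_zero _).2 (Ideal.mul_mem_right _ _ hy2)⟩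

theorem IsCubicPair.natLength_quotient [IsArtinianRing B] (h : IsCubicPair x y) :
    natLength B (B ⧸ Ideal.span {x ^ 2, x * y, y ^ 2}) = 3 := by
  have hε : Function.Surjective
      ((Ideal.span {x ^ 2, x * y, y ^ 2}).mkQ ∘ₗ LinearMap.proj (R := B) (0 : Fin 1)) :=
    (Submodule.mkQ_surjective _).comp fun b => ⟨fun _ => b, rfl⟩
  rw [h.natLength_eq_add_rank hε, h.periodicRank_quotient]
  · rfl
  · intro c hc t
    obtain rfl : t = 0 := Subsingleton.elim _ _
    exact span_sq_le_span ((Submodule.Quotient.mk_eq_zero _).1 hc)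

variable {N : Type} [AddCommGroup N] [Module B N] {j : N →ₗ[B] B}

theorem IsCubicPair.exists_generators (h : IsCubicPair x y)
    (hrange : ∀ b, b ∈ LinearMap.range j ↔ x ^ 2 * b = 0 ∧ x * y * b = 0 ∧ y ^ 2 * b = 0) :
    ∃ u v w : N,
    j u = x ^ 2 * y ∧ j v = x * y ^ 2 ∧ j w = x ^ 2 * y ^ 2 := by
  have hu : x ^ 2 * y ∈ LinearMap.range j := (hrange _).2
    ⟨by linear_combination x * y * h.x_cube, by linear_combination y ^ 2 * h.x_cube,
      by linear_combination x ^ 2 * h.y_cube⟩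
  have hv : x * y ^ 2 ∈ LinearMap.range j := (hrange _).2
    ⟨by linear_combination y ^ 2 * h.x_cube, by linear_combination x ^ 2 * h.y_cube,
      by linear_combination x * y * h.y_cube⟩
  obtain ⟨u, hu⟩ := hu
  obtain ⟨v, hv⟩ := hv
  exact ⟨u, v, y • u, hu, hv, by rw [map_smul, hu, smul_eq_mul]; ring⟩

theorem IsCubicPair.exists_eq_smul_add_smul (h : IsCubicPair x y) (hj : Function.Injective j)
    (hrange : ∀ b, b ∈ LinearMap.range j ↔ x ^ 2 * b = 0 ∧ x * y * b = 0 ∧ y ^ 2 * b = 0)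
    {u v : N} (hu : j u = x ^ 2 * y)
    (hv : j v = x * y ^ 2) (n : N) : ∃ p q : B, n = p • u + q • v := by
  obtain ⟨h1, h2, h3⟩ := (hrange (j n)).1 ⟨n, rfl⟩
  obtain ⟨b, s, hb⟩ := h.of_x_pow_mul (i := 3) (j := 2) (a := 0) le_rfl (by simp)
    (h1.trans (mul_zero _).symm)
  rw [h.y_cube, zero_mul, add_zero, pow_one] at hb
  obtain ⟨c, s, hc⟩ := h.of_x_pow_mul (i := 3) (j := 1) (c := y ^ 2 * b) (a := 0) le_rfl (by simp)
    (by linear_combination h3 - y ^ 2 * hb)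
  rw [h.y_cube, zero_mul, add_zero] at hc
  obtain ⟨p, q, rfl⟩ := h.of_y_pow_mul (i := 2) (j := 2) (by simp) (by simp) hc
  have hm : p ∈ Ideal.span {x, y} := h.mem_of_mul_socle_eq_zero (by
    linear_combination h2 - x * y * hb - q * y * x * h.x_cube)
  obtain ⟨r, t, rfl⟩ := Ideal.mem_span_pair.1 hm
  refine ⟨r, t, hj ?_⟩
  rw [map_add, map_smul, map_smul, hu, hv, hb, smul_eq_mul, smul_eq_mul]
  linear_combination q * h.x_cube

theorem IsCubicPair.periodicRank_annihilator (h : IsCubicPair x y) (hj : Function.Injective j)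
    (hrange : ∀ b, b ∈ LinearMap.range j ↔ x ^ 2 * b = 0 ∧ x * y * b = 0 ∧ y ^ 2 * b = 0)
    (i : ℕ) :
    periodicRank x y N (i + 1) = if Even i then i / 2 + 1 else i + 1 := by
  obtain ⟨u, v, w, hu, hv, hw⟩ := h.exists_generators hrange
  have hxu : x • u = 0 := hj (by
    rw [map_smul, hu, map_zero, smul_eq_mul]; linear_combination y * h.x_cube)
  have hyv : y • v = 0 := hj (by
    rw [map_smul, hv, map_zero, smul_eq_mul]; linear_combination x * h.y_cube)
  have hyu : y • u = w := hj (by rw [map_smul, hu, hw, smul_eq_mul]; ring)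
  have hxv : x • v = w := hj (by rw [map_smul, hv, hw, smul_eq_mul]; ring)
  have hxw : x • w = 0 := by rw [← hyu, smul_comm, hxu, smul_zero]
  have hyw : y • w = 0 := by rw [← hxv, smul_comm, hyv, smul_zero]
  have hle : Ideal.span {x, y} ≤ LinearMap.ker (LinearMap.toSpanSingleton B N w) := by
    rw [Ideal.span_le]
    rintro _ (rfl | rfl)
    · exact hxw
    · exact hyw
  let ι : (B ⧸ Ideal.span {x, y}) →ₗ[B] N := Submodule.liftQ _ _ hle
  have hι : ∀ b : B, ι (Submodule.Quotient.mk b) = b • w := fun b => rfl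
  rw [h.periodicRank_of_residue_injection ι, card_even_or_even]
  · refine (injective_iff_map_eq_zero ι).2 fun t ht => ?_
    obtain ⟨b, rfl⟩ := Submodule.Quotient.mk_surjective _ t
    refine (Submodule.Quotient.mk_eq_zero _).2 (h.mem_of_mul_socle_eq_zero ?_)
    have := congrArg j ht
    rw [hι, map_smul, hw, map_zero, smul_eq_mul] at this
    linear_combination this
  · intro n
    obtain ⟨p, q, rfl⟩ := h.exists_eq_smul_add_smul hj hrange hu hv n
    refine ⟨⟨Submodule.Quotient.mk q, ?_⟩, ⟨Submodule.Quotient.mk p, ?_⟩⟩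
    · rw [hι, smul_add, smul_comm x p, smul_comm x q, hxu, hxv, smul_zero, zero_add]
    · rw [hι, smul_add, smul_comm y p, smul_comm y q, hyu, hyv, smul_zero, add_zero]
  · intro t
    obtain ⟨b, rfl⟩ := Submodule.Quotient.mk_surjective _ t
    exact ⟨b • v, by rw [hι, smul_comm, hxv], by rw [smul_comm, hyv, smul_zero]⟩
  · intro t
    obtain ⟨b, rfl⟩ := Submodule.Quotient.mk_surjective _ t
    exact ⟨b • u, by rw [smul_comm, hxu, smul_zero], by rw [hι, smul_comm, hyu]⟩
  · intro n
    obtain ⟨h1, -, h3⟩ := (hrange (j n)).1 ⟨n, rfl⟩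
    exact ⟨hj (by rw [map_smul, map_zero, smul_eq_mul, h1]),
      hj (by rw [map_smul, map_zero, smul_eq_mul, h3])⟩

theorem IsCubicPair.natLength_annihilator [IsArtinianRing B] (h : IsCubicPair x y)
    (hj : Function.Injective j)
    (hrange : ∀ b, b ∈ LinearMap.range j ↔ x ^ 2 * b = 0 ∧ x * y * b = 0 ∧ y ^ 2 * b = 0) :
    natLength B N = 3 := by
  obtain ⟨u, v, w, hu, hv, hw⟩ := h.exists_generators hrange
  rw [h.natLength_eq_add_rank (ε := Fintype.linearCombination B ![u, v]),
    h.periodicRank_annihilator hj hrange]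
  · rfl
  · intro n
    obtain ⟨p, q, rfl⟩ := h.exists_eq_smul_add_smul hj hrange hu hv n
    exact ⟨![p, q], by simp [Fintype.linearCombination_apply]⟩
  · intro c hc
    have hc := congrArg j hc
    simp only [Fintype.linearCombination_apply, Fin.sum_univ_two, Matrix.cons_val_zero,
      Matrix.cons_val_one, map_add, map_smul, hu, hv, map_zero, smul_eq_mul] at hc
    refine Fin.forall_fin_two.2 ⟨h.mem_of_mul_socle_eq_zero ?_, h.mem_of_mul_socle_eq_zero ?_⟩
    · linear_combination y * hc - c 1 * x * h.y_cube
    · linear_combination x * hc - c 0 * y * h.x_cube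

end Modules

section Dual

variable {B : Type} [CommRing B] {x y : B}

theorem dual_eval_one_injective (I : Ideal B) :
    Function.Injective (LinearMap.applyₗ (Submodule.Quotient.mk 1 : B ⧸ I) :
      Module.Dual B (B ⧸ I) →ₗ[B] B) := by
  intro f g hfg
  refine Submodule.linearMap_qext _ (LinearMap.ext_ring hfg)

theorem mem_range_dual_eval_one (I : Ideal B) (b : B) :
    b ∈ LinearMap.range (LinearMap.applyₗ (Submodule.Quotient.mk 1 : B ⧸ I) :
      Module.Dual B (B ⧸ I) →ₗ[B] B) ↔ ∀ r ∈ I, r * b = 0 := by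
  constructor
  · rintro ⟨f, rfl⟩ r hr
    change r • f (Submodule.Quotient.mk 1) = 0
    rw [← map_smul, ← Submodule.Quotient.mk_smul, smul_eq_mul, mul_one,
      (Submodule.Quotient.mk_eq_zero I).2 hr, map_zero]
  · intro hb
    exact ⟨Submodule.liftQ I (LinearMap.toSpanSingleton B B b) hb, one_smul B b⟩

theorem mem_range_dual_eval_one_span_sq (b : B) :
    b ∈ LinearMap.range
      (LinearMap.applyₗ (Submodule.Quotient.mk 1 : B ⧸ Ideal.span {x ^ 2, x * y, y ^ 2}) :
      Module.Dual B (B ⧸ Ideal.span {x ^ 2, x * y, y ^ 2}) →ₗ[B] B) ↔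
      x ^ 2 * b = 0 ∧ x * y * b = 0 ∧ y ^ 2 * b = 0 := by
  rw [mem_range_dual_eval_one]
  constructor
  · intro hb
    exact ⟨hb _ (Ideal.subset_span (by simp)), hb _ (Ideal.subset_span (by simp)),
      hb _ (Ideal.subset_span (by simp))⟩
  · rintro ⟨h1, h2, h3⟩
    have : Ideal.span {x ^ 2, x * y, y ^ 2} ≤ LinearMap.ker (LinearMap.toSpanSingleton B B b) := by
      rw [Ideal.span_le]
      rintro _ (rfl | rfl | rfl)
      exacts [h1, h2, h3]
    exact fun r hr => this hr

end Dual

theorem exists_of_mk_pow_mul_eq {R : Type} [CommRing R] [DecompositionMonoid R] {X Y : R}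
    (hXY : IsRelPrime X Y) {I : Ideal R} (hI : I = Ideal.span {X ^ 3, Y ^ 3}) {i j : ℕ}
    {c a : R ⧸ I} (hi : i ≤ 3) (hj : j ≤ 3)
    (hca : Ideal.Quotient.mk _ X ^ j * c = Ideal.Quotient.mk _ Y ^ i * a) :
    ∃ p q, c = Ideal.Quotient.mk _ X ^ (3 - j) * p + Ideal.Quotient.mk _ Y ^ i * q := by
  obtain ⟨c, rfl⟩ := Ideal.Quotient.mk_surjective c
  obtain ⟨a, rfl⟩ := Ideal.Quotient.mk_surjective a
  rw [← map_pow, ← map_pow, ← map_mul, ← map_mul, Ideal.Quotient.eq, hI] at hca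
  obtain ⟨s, t, hst⟩ := Ideal.mem_span_pair.1 hca
  have hX3 : X ^ 3 = X ^ j * X ^ (3 - j) := by rw [← pow_add]; congr 1; omega
  have hY3 : Y ^ 3 = Y ^ i * Y ^ (3 - i) := by rw [← pow_add]; congr 1; omega
  have hdvd : Y ^ i ∣ X ^ j * (c - X ^ (3 - j) * s) :=
    ⟨a + Y ^ (3 - i) * t, by linear_combination s * hX3 + t * hY3 - hst⟩
  obtain ⟨q, hq⟩ := (hXY.symm.pow_left.pow_right).dvd_of_dvd_mul_left hdvd
  refine ⟨Ideal.Quotient.mk _ s, Ideal.Quotient.mk _ q, ?_⟩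
  rw [← map_pow, ← map_pow, ← map_mul, ← map_mul, ← map_add]
  congr 1
  linear_combination hq

open MvPolynomial in
theorem exists_eq_C_add (k : Type) [Field k] (f : MvPolynomial (Fin 2) k) :
    ∃ a p q, f = C a + (p * X 0 + q * X 1) := by
  induction f using MvPolynomial.induction_on with
  | C a => exact ⟨a, 0, 0, by simp⟩
  | add f g hf hg =>
    obtain ⟨a, p, q, rfl⟩ := hf
    obtain ⟨b, r, s, rfl⟩ := hg
    exact ⟨a + b, p + r, q + s, by rw [map_add]; ring⟩
  | mul_X f n hf =>
    fin_cases n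
    · exact ⟨0, f, 0, by simp⟩
    · exact ⟨0, 0, f, by simp⟩

theorem isRelPrime_X (k : Type) [Field k] {i j : Fin 2} (hij : i ≠ j) :
    IsRelPrime (MvPolynomial.X i : MvPolynomial (Fin 2) k) (MvPolynomial.X j) := by
  refine (MvPolynomial.X_prime (i := i)).irreducible.isRelPrime_iff_not_dvd.2 ?_
  rwa [MvPolynomial.X_dvd_X]

theorem xB_pow_three (k : Type) [Field k] : xB k ^ 3 = 0 := by
  rw [← map_pow]
  exact Ideal.Quotient.eq_zero_iff_mem.2 (Ideal.subset_span (by simp))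

theorem yB_pow_three (k : Type) [Field k] : yB k ^ 3 = 0 := by
  rw [← map_pow]
  exact Ideal.Quotient.eq_zero_iff_mem.2 (Ideal.subset_span (by simp))

theorem isCubicPair_ringB (k : Type) [Field k] [IsLocalRing (ringB k)] :
    IsCubicPair (xB k) (yB k) where
  x_cube := xB_pow_three k
  y_cube := yB_pow_three k
  isMaximal := by
    have hx : xB k ∈ maximalIdeal (ringB k) := (mem_maximalIdeal _).2 fun hu => by
      simpa [xB_pow_three] using hu.pow 3
    have hy : yB k ∈ maximalIdeal (ringB k) := (mem_maximalIdeal _).2 fun hu => by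
      simpa [yB_pow_three] using hu.pow 3
    have hle : Ideal.span {xB k, yB k} ≤ maximalIdeal (ringB k) := by
      rw [Ideal.span_le]
      rintro _ (rfl | rfl)
      exacts [hx, hy]
    rw [show Ideal.span {xB k, yB k} = maximalIdeal (ringB k) from le_antisymm hle ?_]
    · exact maximalIdeal.isMaximal _
    · intro b hb
      obtain ⟨f, rfl⟩ := Ideal.Quotient.mk_surjective b
      obtain ⟨a, p, q, rfl⟩ := exists_eq_C_add k f
      have hpq : Ideal.Quotient.mk _ (p * MvPolynomial.X 0 + q * MvPolynomial.X 1) ∈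
          Ideal.span {xB k, yB k} :=
        Ideal.mem_span_pair.2 ⟨Ideal.Quotient.mk _ p, Ideal.Quotient.mk _ q, by simp⟩
      rw [map_add] at hb ⊢
      have ha := (Ideal.add_mem_iff_left _ (hle hpq)).1 hb
      obtain rfl : a = 0 := by
        by_contra h0
        exact (mem_maximalIdeal _).1 ha (((IsUnit.mk0 a h0).map MvPolynomial.C).map _)
      simpa using hpq
  of_x_pow_mul := exists_of_mk_pow_mul_eq (isRelPrime_X k (by simp)) rfl
  of_y_pow_mul := exists_of_mk_pow_mul_eq (isRelPrime_X k (by simp)) (by rw [Set.pair_comm])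

theorem isArtinianRing_ringB (k : Type) [Field k] [IsLocalRing (ringB k)] :
    IsArtinianRing (ringB k) := by
  have h := isCubicPair_ringB k
  rw [isArtinianRing_iff_isNilpotent_maximalIdeal, ← eq_maximalIdeal h.isMaximal,
    Ideal.FG.isNilpotent_iff_le_nilradical (IsNoetherian.noetherian _), Ideal.span_le]
  rintro _ (rfl | rfl)
  exacts [⟨3, h.x_cube⟩, ⟨3, h.y_cube⟩]

set_option synthInstance.maxHeartbeats 2000000 in
set_option maxHeartbeats 2000000 in
/-- For `B = k[x,y]/(x³,y³)` (a Noetherian local ring), the module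
`M = B/(x², xy, y²)` and its dual `M^∨ = Hom_B(M, B)` have Betti numbers
`β_i(M) = (3i+2)/2` for even `i`, `(3i+3)/2` for odd `i`, and
`β_i(M^∨) = (3i+4)/2` for even `i`, `(3i+3)/2` for odd `i`. In particular the
quasi-polynomials governing the Betti numbers of `M` and `M^∨` have equal leading
terms but different lower-order terms. -/
theorem stmt_12 (k : Type) [Field k] [IsLocalRing (ringB k)] :
    (∀ β : ℕ → ℕ, IsMinimalFreeResolutionBetti (ringB k) (moduleM k) β →
      ∀ i, β i = if Even i then (3 * i + 2) / 2 else (3 * i + 3) / 2) ∧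
    (∀ β' : ℕ → ℕ,
      IsMinimalFreeResolutionBetti (ringB k) (Module.Dual (ringB k) (moduleM k)) β' →
      ∀ i, β' i = if Even i then (3 * i + 4) / 2 else (3 * i + 3) / 2) := by
  have h := isCubicPair_ringB k
  have := isArtinianRing_ringB k
  refine ⟨fun β hβ i => ?_, fun β' hβ' i => ?_⟩
  · have hi := h.betti_eq i _ β hβ
    rw [h.natLength_quotient, h.periodicRank_quotient] at hi
    cases i with
    | zero =>
      simp [periodicRank] at hi ⊢
      omega
    | succ i =>
      rw [h.periodicRank_quotient] at hi
      grind
  · have hj := dual_eval_one_injective (Ideal.span {xB k ^ 2, xB k * yB k, yB k ^ 2})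
    have hrange := mem_range_dual_eval_one_span_sq (x := xB k) (y := yB k)
    have hi := h.betti_eq i _ β' hβ'
    rw [h.natLength_annihilator hj hrange, h.periodicRank_annihilator hj hrange] at hi
    cases i with
    | zero =>
      simp [periodicRank] at hi ⊢
      omega
    | succ i =>
      rw [h.periodicRank_annihilator hj hrange] at hi
      grind
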